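/- arXiv:1706.06568 — 2 statements merged into one kernel-verified Lean document; each statement's English description precedes it below -/
import Mathlib

section
/- Let N_T, N_S be integers with 1 ≤ N_S ≤ N_T, let μ_1, μ_2 > 0, s > 0, t > 0. For i ∈ {1,2} let X^i_1, …, X^i_{N_T} be i.i.d. exponential with mean μ_i, the two families mutually independent, with order statistics Y^i_1 ≤ … ≤ Y^i_{N_T}. Let b be uniformly distributed on {0,1}^{N_S} with Hamming weight W, and conditionally on W = w ≥ 1 let B_1, B_2 be independent uniformly random size-w subsets of T = {N_T−N_S+1,…,N_T}, everything independent of the channel gains. Define the outage event: if W = 0, the event {min(Y^1_{N_T−N_S}, Y^2_{N_T−N_S}) < s/t}; if W = w ≥ 1, the event {∃ i ∈ {1,2}, ∃ ξ ∈ B_i with Y^i_ξ < s w/t}. Then the outage probability equals 2^{−N_S}·{ [q_1 + q_2 − q_1 q_2] + ∑_{w=1}^{N_S} C(N_S,w)·[p_1(w) + p_2(w) − p_1(w) p_2(w)] }, where q_i = F_{i(N_T−N_S)}(s/t), p_i(w) = ∑_{ξ=N_T−N_S+1}^{N_T−w+1} [C(N_T−ξ, w−1)/C(N_S,w)] F_{i(ξ)}(s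 w/t), and F_{i(ξ)}(y) = ∑_{n=ξ}^{N_T} C(N_T,n)(1 − e^{−y/μ_i})^n (e^{−y/μ_i})^{N_T−n}. -/
open MeasureTheory ProbabilityTheory

/-- Discrete σ-algebra on finite subsets of ℕ. -/
instance : MeasurableSpace (Finset ℕ) := ⊤

/-- Hamming weight of a bit string. -/
def wt {n : ℕ} (b : Fin n → Bool) : ℕ := (Finset.univ.filter fun j => b j = true).card

/-- Joint law of the index bit stream `b` (uniform on `{0,1}^{N_S}`) and of the two active
rank sets `B₁, B₂`, which conditionally on `wt b = w` are independent uniform size-`w`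
subsets of `T = {N_T−N_S+1,…,N_T}`. -/
noncomputable def selLaw (NT NS : ℕ) :
    Measure ((Fin NS → Bool) × Finset ℕ × Finset ℕ) :=
  (uniformOn (Set.univ : Set (Fin NS → Bool))).bind fun b =>
    ((uniformOn (((Finset.Icc (NT - NS + 1) NT).powersetCard (wt b) : Finset (Finset ℕ)) :
        Set (Finset ℕ))).prod
      (uniformOn (((Finset.Icc (NT - NS + 1) NT).powersetCard (wt b) : Finset (Finset ℕ)) :
        Set (Finset ℕ)))).map fun B => (b, B.1, B.2)

/-- The CDF of the `ξ`-th smallest order statistic of `N_T` i.i.d. exponentials with mean `μ`. -/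
noncomputable def FOrd (NT ξ : ℕ) (μ y : ℝ) : ℝ :=
  ∑ n ∈ Finset.Icc ξ NT,
    (NT.choose n : ℝ) * (1 - Real.exp (-y / μ)) ^ n * Real.exp (-y / μ) ^ (NT - n)

/-- `p_i(w) = ∑_{ξ=N_T−N_S+1}^{N_T−w+1} [C(N_T−ξ,w−1)/C(N_S,w)]·F_{i(ξ)}(s·w/t)`. -/
noncomputable def pW (NT NS : ℕ) (μ s t : ℝ) (w : ℕ) : ℝ :=
  ∑ ξ ∈ Finset.Icc (NT - NS + 1) (NT - w + 1),
    ((NT - ξ).choose (w - 1) : ℝ) / (NS.choose w : ℝ) * FOrd NT ξ μ (s * w / t)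

instance : DiscreteMeasurableSpace (Finset ℕ) := ⟨fun _ => MeasurableSpace.measurableSet_top⟩

theorem measurable_card_filter_lt {ι : Type*} [Fintype ι] (y : ℝ) :
    Measurable fun x : ι → ℝ => (Finset.univ.filter fun n => x n < y).card := by
  simp only [Finset.card_filter]
  refine Finset.measurable_sum _ fun n _ => ?_
  exact Measurable.ite (measurableSet_lt (measurable_pi_apply n) measurable_const)
    measurable_const measurable_const

theorem expMeasure_real_Iio {μ y : ℝ} (hμ : 0 < μ) (hy : 0 ≤ y) :
    (expMeasure (1 / μ)).real (Set.Iio y) = 1 - Real.exp (-y / μ) := by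
  have : IsProbabilityMeasure (expMeasure (1 / μ)) :=
    isProbabilityMeasure_expMeasure (one_div_pos.2 hμ)
  have : NullSingletonClass (expMeasure (1 / μ)) := by
    unfold expMeasure gammaMeasure; infer_instance
  rw [measureReal_congr Iio_ae_eq_Iic, ← cdf_eq_real, cdf_expMeasure_eq (one_div_pos.2 hμ),
    if_pos hy]
  congr 2
  ring

/-- The number of i.i.d. coordinates falling below `y` is binomially distributed. -/
theorem pi_real_le_card_filter_lt (N k : ℕ) (ν : Measure ℝ) [IsProbabilityMeasure ν] (y : ℝ) :
    (Measure.pi fun _ : Fin N => ν).real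
        {x | k ≤ (Finset.univ.filter fun n => x n < y).card} =
      ∑ n ∈ Finset.Icc k N, (N.choose n : ℝ) * ν.real (Set.Iio y) ^ n *
        (1 - ν.real (Set.Iio y)) ^ (N - n) := by
  classical
  set q := ν.real (Set.Iio y)
  have hq : ν.real (Set.Ici y) = 1 - q := by
    rw [← Set.compl_Iio, probReal_compl_eq_one_sub measurableSet_Iio]
  let box : Finset (Fin N) → Set (Fin N → ℝ) := fun S =>
    Set.univ.pi fun n => if n ∈ S then Set.Iio y else Set.Ici y
  have hbox : ∀ S x, x ∈ box S ↔ (Finset.univ.filter fun n => x n < y) = S := by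
    intro S x
    simp only [box, Set.mem_univ_pi, Finset.ext_iff, Finset.mem_filter, Finset.mem_univ, true_and]
    refine forall_congr' fun n => ?_
    by_cases h : n ∈ S <;> simp [h]
  have hunion : {x : Fin N → ℝ | k ≤ (Finset.univ.filter fun n => x n < y).card} =
      ⋃ S ∈ Finset.univ.filter (fun S : Finset (Fin N) => k ≤ S.card), box S := by
    ext x
    simp [hbox]
  have hmeas : ∀ S, (Measure.pi fun _ : Fin N => ν).real (box S) =
      q ^ S.card * (1 - q) ^ (N - S.card) := by
    intro S
    rw [measureReal_def, Measure.pi_pi, ENNReal.toReal_prod]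
    have : ∀ n, (ν (if n ∈ S then Set.Iio y else Set.Ici y)).toReal =
        if n ∈ S then q else 1 - q := by
      intro n
      split_ifs
      · rfl
      · exact hq
    simp only [this]
    rw [Finset.prod_ite, Finset.prod_const, Finset.prod_const, Finset.filter_not,
      Finset.filter_mem_eq_inter, Finset.univ_inter, ← Finset.compl_eq_univ_sdiff,
      Finset.card_compl, Fintype.card_fin]
  rw [hunion, measureReal_biUnion_finset]
  · simp only [hmeas]
    rw [Finset.sum_filter, ← Finset.powerset_univ,
      Finset.sum_powerset_apply_card
        (fun m => if k ≤ m then q ^ m * (1 - q) ^ (N - m) else 0), Finset.card_univ,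
      Fintype.card_fin]
    simp only [smul_ite, smul_zero, nsmul_eq_mul, ← mul_assoc]
    rw [← Finset.sum_filter]
    refine Finset.sum_congr ?_ fun _ _ => rfl
    ext m
    simp only [Finset.mem_filter, Finset.mem_range, Finset.mem_Icc]
    omega
  · intro S _ S' _ hne
    refine Set.disjoint_left.2 fun x hx hx' => hne ?_
    rw [← (hbox S x).1 hx, (hbox S' x).1 hx']
  · intro S _
    refine MeasurableSet.univ_pi fun n => ?_
    split_ifs
    exacts [measurableSet_Iio, measurableSet_Ici]

theorem pi_expMeasure_real_le_card (N k : ℕ) {μ y : ℝ} (hμ : 0 < μ) (hy : 0 ≤ y) :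
    (Measure.pi fun _ : Fin N => expMeasure (1 / μ)).real
        {x | k ≤ (Finset.univ.filter fun n => x n < y).card} = FOrd N k μ y := by
  have : IsProbabilityMeasure (expMeasure (1 / μ)) :=
    isProbabilityMeasure_expMeasure (one_div_pos.2 hμ)
  rw [pi_real_le_card_filter_lt, expMeasure_real_Iio hμ hy, FOrd]
  simp

/-- Summing a function of the minimum over the `(k+1)`-subsets of `[a, N]`. -/
theorem sum_powersetCard_Icc_of_min (N k : ℕ) (g : Finset ℕ → ℝ) (h : ℕ → ℝ)
    (hg : ∀ B ξ, ξ ∈ B → (∀ ζ ∈ B, ξ ≤ ζ) → g B = h ξ) (d a : ℕ) (had : N + 1 = a + d) :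
    ∑ B ∈ (Finset.Icc a N).powersetCard (k + 1), g B =
      ∑ ξ ∈ Finset.Icc a N, ((N - ξ).choose k : ℝ) * h ξ := by
  induction d generalizing a with
  | zero =>
    rw [Finset.Icc_eq_empty (by omega)]
    rw [Finset.powersetCard_eq_empty.2 (by simp)]
    simp
  | succ d ih =>
    have ha : a ∉ Finset.Icc (a + 1) N := by simp
    rw [← Finset.insert_Icc_add_one_left_eq_Icc (show a ≤ N by omega),
      Finset.powersetCard_succ_insert ha, Finset.sum_union, ih (a + 1) (by omega),
      Finset.sum_insert ha, add_comm, Finset.sum_image]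
    · congr 1
      have : ∀ C ∈ (Finset.Icc (a + 1) N).powersetCard k, g (insert a C) = h a := by
        intro C hC
        refine hg _ a (Finset.mem_insert_self a C) fun ζ hζ => ?_
        rcases Finset.mem_insert.1 hζ with rfl | hζ
        · exact le_rfl
        · have := Finset.mem_Icc.1 ((Finset.mem_powersetCard.1 hC).1 hζ)
          omega
      rw [Finset.sum_congr rfl this, Finset.sum_const, Finset.card_powersetCard, Nat.card_Icc,
        nsmul_eq_mul]
      congr 3
      omega
    · intro C hC C' hC' hCC
      have hn : ∀ D ∈ (Finset.Icc (a + 1) N).powersetCard k, a ∉ D := fun D hD haD =>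
        ha ((Finset.mem_powersetCard.1 hD).1 haD)
      rw [← Finset.erase_insert (hn C hC), ← Finset.erase_insert (hn C' hC')]
      exact congrArg (fun D => D.erase a) hCC
    · refine Finset.disjoint_left.2 fun B hB hB' => ?_
      obtain ⟨C, -, rfl⟩ := Finset.mem_image.1 hB'
      exact ha ((Finset.mem_powersetCard.1 hB).1 (Finset.mem_insert_self a C))

theorem lintegral_uniformOn_coe {α : Type*} [MeasurableSpace α] [MeasurableSingletonClass α]
    (S : Finset α) (f : α → ENNReal) :
    ∫⁻ x, f x ∂(uniformOn (S : Set α)) = (S.card : ENNReal)⁻¹ * ∑ x ∈ S, f x := by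
  rw [uniformOn, ProbabilityTheory.cond, lintegral_smul_measure, lintegral_finset, Measure.count_apply_finset]
  simp

theorem sum_wt {n : ℕ} (G : ℕ → ℝ) :
    ∑ b : Fin n → Bool, G (wt b) = ∑ w ∈ Finset.range (n + 1), (n.choose w : ℝ) * G w := by
  have := Finset.sum_powerset_apply_card G (x := (Finset.univ : Finset (Fin n)))
  simp only [Finset.powerset_univ, Finset.card_univ, Fintype.card_fin, nsmul_eq_mul] at this
  rw [← this]
  refine Fintype.sum_bijective (fun b : Fin n → Bool => Finset.univ.filter fun j => b j = true)
    ⟨fun b c hbc => ?_, fun S => ⟨fun j => decide (j ∈ S), by ext; simp⟩⟩ _ _ fun b => rfl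
  funext j
  have := Finset.ext_iff.1 hbc j
  rw [Bool.eq_iff_iff]
  simpa using this

/-- Two independent hops: the outage of at least one of them. -/
theorem pi_fin_two_exists {α : Type*} [MeasurableSpace α] (Q : Fin 2 → Measure α)
    [∀ i, IsProbabilityMeasure (Q i)] (A : Fin 2 → Set α) (hA : ∀ i, MeasurableSet (A i)) :
    Measure.pi Q {x | ∃ i, x i ∈ A i} = ENNReal.ofReal
      ((Q 0).real (A 0) + (Q 1).real (A 1) - (Q 0).real (A 0) * (Q 1).real (A 1)) := by
  have : {x : Fin 2 → α | ∃ i, x i ∈ A i} = (Set.univ.pi fun i => (A i)ᶜ)ᶜ := by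
    ext x
    simp only [Set.mem_ofPred_eq, Set.mem_compl_iff, Set.mem_univ_pi, not_forall, not_not]
  rw [this, ← ofReal_measureReal,
    probReal_compl_eq_one_sub (MeasurableSet.univ_pi fun i => (hA i).compl),
    measureReal_def, Measure.pi_pi, ENNReal.toReal_prod, Fin.prod_univ_two]
  simp only [← measureReal_def]
  rw [probReal_compl_eq_one_sub (hA 0), probReal_compl_eq_one_sub (hA 1)]
  congr 1
  ring

theorem lintegral_selLaw (NT NS : ℕ) (f : (Fin NS → Bool) × Finset ℕ × Finset ℕ → ENNReal) :
    ∫⁻ p, f p ∂(selLaw NT NS) = (2 ^ NS : ENNReal)⁻¹ * ∑ b : Fin NS → Bool,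
      (((Finset.Icc (NT - NS + 1) NT).powersetCard (wt b)).card : ENNReal)⁻¹ *
        ∑ B₁ ∈ (Finset.Icc (NT - NS + 1) NT).powersetCard (wt b),
          (((Finset.Icc (NT - NS + 1) NT).powersetCard (wt b)).card : ENNReal)⁻¹ *
            ∑ B₂ ∈ (Finset.Icc (NT - NS + 1) NT).powersetCard (wt b), f (b, B₁, B₂) := by
  rw [selLaw, Measure.lintegral_bind (measurable_of_countable _).aemeasurable
    (measurable_of_countable _).aemeasurable, ← Finset.coe_univ, lintegral_uniformOn_coe]
  congr 1
  · simp
  · refine Finset.sum_congr rfl fun b _ => ?_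
    rw [lintegral_map (measurable_of_countable _) (measurable_of_countable _), lintegral_prod _
      (measurable_of_countable _).aemeasurable, lintegral_uniformOn_coe]
    simp only [lintegral_uniformOn_coe]

instance (NT NS : ℕ) : IsFiniteMeasure (selLaw NT NS) := by
  refine ⟨lt_of_le_of_lt ?_ ENNReal.one_lt_top⟩
  rw [selLaw, Measure.bind_apply MeasurableSet.univ (measurable_of_countable _).aemeasurable]
  refine (lintegral_mono (g := fun _ => 1) fun b => ?_).trans (by simp)
  rw [Measure.map_apply (measurable_of_countable _) MeasurableSet.univ, Set.preimage_univ,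
    ← Set.univ_prod_univ, Measure.prod_prod]
  exact mul_le_one' prob_le_one prob_le_one

theorem average_union_ofReal {α : Type*} (S : Finset α) (hS : S.Nonempty) (g₁ g₂ : α → ℝ)
    (h₁ : ∀ B, 0 ≤ g₁ B ∧ g₁ B ≤ 1) (h₂ : ∀ B, 0 ≤ g₂ B) :
    (S.card : ENNReal)⁻¹ * ∑ B₁ ∈ S, (S.card : ENNReal)⁻¹ *
        ∑ B₂ ∈ S, ENNReal.ofReal (g₁ B₁ + g₂ B₂ - g₁ B₁ * g₂ B₂) =
      ENNReal.ofReal ((S.card : ℝ)⁻¹ * ∑ B ∈ S, g₁ B + (S.card : ℝ)⁻¹ * ∑ B ∈ S, g₂ B -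
        ((S.card : ℝ)⁻¹ * ∑ B ∈ S, g₁ B) * ((S.card : ℝ)⁻¹ * ∑ B ∈ S, g₂ B)) := by
  have hc : (0 : ℝ) < S.card := by exact_mod_cast hS.card_pos
  have hinv : (S.card : ENNReal)⁻¹ = ENNReal.ofReal (S.card : ℝ)⁻¹ := by
    rw [ENNReal.ofReal_inv_of_pos hc, ENNReal.ofReal_natCast]
  have hpos : ∀ B₁ B₂, 0 ≤ g₁ B₁ + g₂ B₂ - g₁ B₁ * g₂ B₂ := fun B₁ B₂ => by
    nlinarith [h₁ B₁, h₂ B₂]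
  have hpos' : ∀ B₁, 0 ≤ ∑ B₂ ∈ S, (g₁ B₁ + g₂ B₂ - g₁ B₁ * g₂ B₂) := fun B₁ =>
    Finset.sum_nonneg fun B₂ _ => hpos B₁ B₂
  have hc' : (0 : ℝ) ≤ (S.card : ℝ)⁻¹ := inv_nonneg.2 hc.le
  simp_rw [hinv, ← ENNReal.ofReal_sum_of_nonneg fun B₂ _ => hpos _ B₂, ← ENNReal.ofReal_mul hc']
  rw [← ENNReal.ofReal_sum_of_nonneg fun B₁ _ => mul_nonneg hc' (hpos' B₁),
    ← ENNReal.ofReal_mul hc']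
  congr 1
  simp only [Finset.sum_add_distrib, Finset.sum_sub_distrib, ← Finset.mul_sum, ← Finset.sum_mul,
    Finset.sum_const, nsmul_eq_mul]
  field_simp

theorem average_outage_eq_pW {NT NS w : ℕ} (hNT : NS ≤ NT) (hw : 1 ≤ w) (hwS : w ≤ NS)
    {μ s t : ℝ} (hμ : 0 < μ) (hs : 0 < s) (ht : 0 < t) :
    (((Finset.Icc (NT - NS + 1) NT).powersetCard w).card : ℝ)⁻¹ *
      ∑ B ∈ (Finset.Icc (NT - NS + 1) NT).powersetCard w,
        (Measure.pi fun _ : Fin NT => expMeasure (1 / μ)).real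
          {x | ∃ ξ ∈ B, ξ ≤ (Finset.univ.filter fun n => x n < s * w / t).card} =
      pW NT NS μ s t w := by
  obtain ⟨k, rfl⟩ : ∃ k, w = k + 1 := ⟨w - 1, by omega⟩
  have hy : 0 ≤ s * (k + 1 : ℕ) / t := by positivity
  rw [sum_powersetCard_Icc_of_min NT k _ (fun ξ => FOrd NT ξ μ (s * (k + 1 : ℕ) / t)) _ NS _
    (by omega), Finset.card_powersetCard, Nat.card_Icc, pW, Finset.mul_sum]
  · have hsub : Finset.Icc (NT - NS + 1) (NT - (k + 1) + 1) ⊆ Finset.Icc (NT - NS + 1) NT :=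
      Finset.Icc_subset_Icc_right (by omega)
    rw [show NT + 1 - (NT - NS + 1) = NS by omega, ← Finset.sum_subset hsub]
    · refine Finset.sum_congr rfl fun ξ _ => ?_
      rw [Nat.add_sub_cancel]
      ring
    · intro ξ hξ hξ'
      rw [Finset.mem_Icc] at hξ hξ'
      have : (NT - ξ).choose k = 0 := Nat.choose_eq_zero_of_lt (by omega)
      simp [this]
  · intro B ξ hξ hmin
    rw [← pi_expMeasure_real_le_card NT ξ hμ hy]
    congr 1
    ext x
    exact ⟨fun ⟨ζ, hζ, h⟩ => (hmin ζ hζ).trans h, fun h => ⟨ξ, hξ, h⟩⟩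

theorem FOrd_mem_Icc (N k : ℕ) {μ y : ℝ} (hμ : 0 < μ) (hy : 0 ≤ y) :
    0 ≤ FOrd N k μ y ∧ FOrd N k μ y ≤ 1 := by
  have : IsProbabilityMeasure (expMeasure (1 / μ)) :=
    isProbabilityMeasure_expMeasure (one_div_pos.2 hμ)
  rw [← pi_expMeasure_real_le_card N k hμ hy]
  exact ⟨measureReal_nonneg, measureReal_le_one⟩

theorem pW_mem_Icc {NT NS w : ℕ} (hNT : NS ≤ NT) (hw : 1 ≤ w) (hwS : w ≤ NS)
    {μ s t : ℝ} (hμ : 0 < μ) (hs : 0 < s) (ht : 0 < t) :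
    0 ≤ pW NT NS μ s t w ∧ pW NT NS μ s t w ≤ 1 := by
  have : IsProbabilityMeasure (expMeasure (1 / μ)) :=
    isProbabilityMeasure_expMeasure (one_div_pos.2 hμ)
  rw [← average_outage_eq_pW hNT hw hwS hμ hs ht]
  refine ⟨mul_nonneg (by positivity) (Finset.sum_nonneg fun _ _ => measureReal_nonneg),
    inv_mul_le_one_of_le₀ ?_ (by positivity)⟩
  refine (Finset.sum_le_card_nsmul _ _ (1 : ℝ) fun B _ => ?_).trans_eq (by simp)
  exact measureReal_le_one

/-- Exact average outage probability of the two-hop DF adaptive OFDM IM system with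
decentralized mapping scheme selection and the dual-mode transmission protocol.
The two hops have i.i.d. exponential subcarrier gains with means `μ₁, μ₂`; the event
`Y^i_ξ < y` is expressed as `ξ ≤ #{n : X^i_n < y}`. -/
theorem stmt_7 (NT NS : ℕ) (hNS : 1 ≤ NS) (hNT : NS ≤ NT)
    (μ₁ μ₂ s t : ℝ) (hμ₁ : 0 < μ₁) (hμ₂ : 0 < μ₂) (hs : 0 < s) (ht : 0 < t) :
    ((Measure.pi fun i : Fin 2 =>
        Measure.pi fun _ : Fin NT => expMeasure (1 / ![μ₁, μ₂] i)).prod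
      (selLaw NT NS))
      {p : (Fin 2 → Fin NT → ℝ) × ((Fin NS → Bool) × Finset ℕ × Finset ℕ) |
        if wt p.2.1 = 0 then
          ∃ i : Fin 2, NT - NS ≤ (Finset.univ.filter fun n => p.1 i n < s / t).card
        else
          ∃ i : Fin 2, ∃ ξ ∈ ![p.2.2.1, p.2.2.2] i,
            ξ ≤ (Finset.univ.filter fun n => p.1 i n < s * (wt p.2.1) / t).card}
      = ENNReal.ofReal ((1 / 2 ^ NS) *
          ((FOrd NT (NT - NS) μ₁ (s / t) + FOrd NT (NT - NS) μ₂ (s / t)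
              - FOrd NT (NT - NS) μ₁ (s / t) * FOrd NT (NT - NS) μ₂ (s / t))
            + ∑ w ∈ Finset.Icc 1 NS, (NS.choose w : ℝ) *
                (pW NT NS μ₁ s t w + pW NT NS μ₂ s t w
                  - pW NT NS μ₁ s t w * pW NT NS μ₂ s t w))) := by
  have hprob : ∀ i : Fin 2, IsProbabilityMeasure (expMeasure (1 / ![μ₁, μ₂] i)) := by
    intro i
    fin_cases i
    exacts [isProbabilityMeasure_expMeasure (one_div_pos.2 hμ₁),
      isProbabilityMeasure_expMeasure (one_div_pos.2 hμ₂)]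
  have hcoord : ∀ (k : ℕ) (y : ℝ), MeasurableSet
      {x : Fin NT → ℝ | k ≤ (Finset.univ.filter fun n => x n < y).card} := fun k y =>
    measurableSet_le measurable_const (measurable_card_filter_lt y)
  have hrank : ∀ (B : Finset ℕ) (y : ℝ), MeasurableSet
      {x : Fin NT → ℝ | ∃ ξ ∈ B, ξ ≤ (Finset.univ.filter fun n => x n < y).card} := by
    intro B y
    have := B.measurableSet_biUnion fun ξ _ => hcoord ξ y
    convert this using 1
    ext x
    simp
  let A : (Fin NS → Bool) × Finset ℕ × Finset ℕ → Fin 2 → Set (Fin NT → ℝ) := fun c i =>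
    if wt c.1 = 0 then {x | NT - NS ≤ (Finset.univ.filter fun n => x n < s / t).card}
    else {x | ∃ ξ ∈ ![c.2.1, c.2.2] i,
      ξ ≤ (Finset.univ.filter fun n => x n < s * (wt c.1) / t).card}
  have hA : ∀ c i, MeasurableSet (A c i) := by
    intro c i
    simp only [A]
    split_ifs
    exacts [hcoord _ _, hrank _ _]
  have hset : {p : (Fin 2 → Fin NT → ℝ) × ((Fin NS → Bool) × Finset ℕ × Finset ℕ) |
        if wt p.2.1 = 0 then
          ∃ i : Fin 2, NT - NS ≤ (Finset.univ.filter fun n => p.1 i n < s / t).card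
        else
          ∃ i : Fin 2, ∃ ξ ∈ ![p.2.2.1, p.2.2.2] i,
            ξ ≤ (Finset.univ.filter fun n => p.1 i n < s * (wt p.2.1) / t).card} =
      {p | ∃ i, p.1 i ∈ A p.2 i} := by
    ext ⟨x, c⟩
    simp only [A, Set.mem_ofPred_eq]
    split_ifs <;> rfl
  have hmeas : MeasurableSet {p : (Fin 2 → Fin NT → ℝ) ×
      ((Fin NS → Bool) × Finset ℕ × Finset ℕ) | ∃ i, p.1 i ∈ A p.2 i} := by
    refine measurableSet_setOfPred.2 (measurable_from_prod_countable_left fun c => ?_)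
    refine measurableSet_setOfPred.1 ?_
    simp only [Set.ofPred_exists]
    exact MeasurableSet.iUnion fun i => measurable_pi_apply i (hA c i)
  rw [hset, Measure.prod_apply_symm hmeas, lintegral_selLaw]
  let G : ℕ → ℝ := fun w =>
    if w = 0 then FOrd NT (NT - NS) μ₁ (s / t) + FOrd NT (NT - NS) μ₂ (s / t)
      - FOrd NT (NT - NS) μ₁ (s / t) * FOrd NT (NT - NS) μ₂ (s / t)
    else pW NT NS μ₁ s t w + pW NT NS μ₂ s t w - pW NT NS μ₁ s t w * pW NT NS μ₂ s t w
  have hwt : ∀ b : Fin NS → Bool, wt b ≤ NS := fun b =>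
    (Finset.card_le_univ _).trans_eq (Fintype.card_fin NS)
  have hst : 0 ≤ s / t := by positivity
  have hG : ∀ b : Fin NS → Bool, 0 ≤ G (wt b) := by
    intro b
    simp only [G]
    split_ifs with h
    · nlinarith [FOrd_mem_Icc NT (NT - NS) hμ₁ hst, FOrd_mem_Icc NT (NT - NS) hμ₂ hst]
    · nlinarith [pW_mem_Icc hNT (Nat.one_le_iff_ne_zero.2 h) (hwt b) hμ₁ hs ht,
        pW_mem_Icc hNT (Nat.one_le_iff_ne_zero.2 h) (hwt b) hμ₂ hs ht]
  have hpow : (2 ^ NS : ENNReal)⁻¹ = ENNReal.ofReal (1 / 2 ^ NS) := by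
    rw [one_div, ENNReal.ofReal_inv_of_pos (by positivity), ENNReal.ofReal_pow (by norm_num),
      ENNReal.ofReal_ofNat]
  have hsum : (FOrd NT (NT - NS) μ₁ (s / t) + FOrd NT (NT - NS) μ₂ (s / t)
              - FOrd NT (NT - NS) μ₁ (s / t) * FOrd NT (NT - NS) μ₂ (s / t))
            + ∑ w ∈ Finset.Icc 1 NS, (NS.choose w : ℝ) *
                (pW NT NS μ₁ s t w + pW NT NS μ₂ s t w
                  - pW NT NS μ₁ s t w * pW NT NS μ₂ s t w) = ∑ b : Fin NS → Bool, G (wt b) := by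
    rw [sum_wt, Finset.range_eq_Ico, Finset.sum_eq_sum_Ico_succ_bot (Nat.succ_pos NS)]
    congr 1
    · simp [G]
    · refine Finset.sum_congr (by ext; simp) fun w hw => ?_
      have : w ≠ 0 := by have := Finset.mem_Icc.1 hw; omega
      simp [G, this]
  rw [hsum, hpow, ENNReal.ofReal_mul (by positivity),
    ENNReal.ofReal_sum_of_nonneg fun b _ => hG b]
  congr 1
  refine Finset.sum_congr rfl fun b _ => ?_
  simp only [Set.preimage_ofPred_eq, pi_fin_two_exists _ _ (hA _)]
  have hp₁ : IsProbabilityMeasure (expMeasure (1 / μ₁)) := hprob 0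
  have hp₂ : IsProbabilityMeasure (expMeasure (1 / μ₂)) := hprob 1
  by_cases hb : wt b = 0
  · simp only [A, G, hb, if_true, Finset.powersetCard_zero, Finset.sum_singleton,
      Finset.card_singleton, Nat.cast_one, inv_one, one_mul]
    simp [← pi_expMeasure_real_le_card NT (NT - NS) hμ₁ hst,
      ← pi_expMeasure_real_le_card NT (NT - NS) hμ₂ hst]
  · simp only [A, G, hb, if_false, Matrix.cons_val_zero, Matrix.cons_val_one]
    rw [← average_outage_eq_pW hNT (Nat.one_le_iff_ne_zero.2 hb) (hwt b) hμ₁ hs ht,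
      ← average_outage_eq_pW hNT (Nat.one_le_iff_ne_zero.2 hb) (hwt b) hμ₂ hs ht]
    have hne : ((Finset.Icc (NT - NS + 1) NT).powersetCard (wt b)).Nonempty := by
      rw [Finset.powersetCard_nonempty, Nat.card_Icc]
      have := hwt b
      omega
    exact average_union_ofReal _ hne
      (fun B => (Measure.pi fun _ : Fin NT => expMeasure (1 / μ₁)).real
        {x | ∃ ξ ∈ B, ξ ≤ (Finset.univ.filter fun n => x n < s * (wt b) / t).card})
      (fun B => (Measure.pi fun _ : Fin NT => expMeasure (1 / μ₂)).real
        {x | ∃ ξ ∈ B, ξ ≤ (Finset.univ.filter fun n => x n < s * (wt b) / t).card})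
      (fun B => ⟨measureReal_nonneg, measureReal_le_one⟩) fun B => measureReal_nonneg
end

section
/- Let N_T, N_S be integers with 1 ≤ N_S < N_T, let μ_1, μ_2 > 0 and s > 0. For i ∈ {1,2} define F_{i(ξ)}(y) = ∑_{n=ξ}^{N_T} C(N_T,n)(1 − e^{−y/μ_i})^n (e^{−y/μ_i})^{N_T−n}, and for t > 0 define P̄_o(t) = 2^{−N_S}·{ [q_1(t) + q_2(t) − q_1(t) q_2(t)] + ∑_{w=1}^{N_S} C(N_S,w)·[p_1(w,t) + p_2(w,t) − p_1(w,t) p_2(w,t)] }, where q_i(t) = F_{i(N_T−N_S)}(s/t) and p_i(w,t) = ∑_{ξ=N_T−N_S+1}^{N_T−w+1} [C(N_T−ξ, w−1)/C(N_S,w)] F_{i(ξ)}(s w/t). Then lim_{t → ∞} t^{N_T−N_S} · P̄_o(t) = [C(N_T, N_T−N_S)/2^{N_S}] · (μ_1^{−(N_T−N_S)} + μ_2^{−(N_T−N_S)}) · s^{N_T−N_S}. -/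
open Filter Topology

/-- The exact average outage probability (decentralized mapping scheme selection). -/
noncomputable def Pout (NT NS : ℕ) (μ₁ μ₂ s t : ℝ) : ℝ :=
  (1 / 2 ^ NS) *
    ((FOrd NT (NT - NS) μ₁ (s / t) + FOrd NT (NT - NS) μ₂ (s / t)
        - FOrd NT (NT - NS) μ₁ (s / t) * FOrd NT (NT - NS) μ₂ (s / t))
      + ∑ w ∈ Finset.Icc 1 NS, (NS.choose w : ℝ) *
          (pW NT NS μ₁ s t w + pW NT NS μ₂ s t w
            - pW NT NS μ₁ s t w * pW NT NS μ₂ s t w))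

/-- Leading behaviour of `FOrd` at small argument: `t ^ d * FOrd NT ξ μ (c / t)` converges
whenever `d ≤ ξ`, and only a term of index `d` survives in the limit. -/
theorem tendsto_pow_mul_FOrd (NT : ℕ) {ξ d : ℕ} (hd : d ≤ ξ) (μ c : ℝ) :
    Tendsto (fun t : ℝ => t ^ d * FOrd NT ξ μ (c / t)) atTop
      (𝓝 (∑ n ∈ Finset.Icc ξ NT, (NT.choose n : ℝ) * ((c / μ) ^ d * 0 ^ (n - d)))) := by
  have harg : Tendsto (fun t : ℝ => -(c / t) / μ) atTop (𝓝 0) := by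
    simpa using ((tendsto_const_nhds (x := c)).div_atTop tendsto_id).neg.div_const μ
  have hexp : Tendsto (fun t : ℝ => Real.exp (-(c / t) / μ)) atTop (𝓝 1) := by
    simpa using harg.rexp
  have hsub : Tendsto (fun t : ℝ => 1 - Real.exp (-(c / t) / μ)) atTop (𝓝 0) := by
    simpa using hexp.const_sub 1
  have hderiv : HasDerivAt (fun x : ℝ => 1 - Real.exp (-(c / μ) * x)) (c / μ) 0 := by
    have h := ((hasDerivAt_id (0 : ℝ)).const_mul (-(c / μ))).exp.const_sub 1
    simpa using h
  have hmul : Tendsto (fun t : ℝ => t * (1 - Real.exp (-(c / t) / μ))) atTop (𝓝 (c / μ)) := by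
    have h := hderiv.tendsto_slope_zero_right.comp tendsto_inv_atTop_nhdsGT_zero
    refine h.congr fun t => ?_
    have e : -(c / μ * t⁻¹) = -(c / t) / μ := by ring
    simp [e]
  have hsum : Tendsto (fun t : ℝ => ∑ n ∈ Finset.Icc ξ NT, (NT.choose n : ℝ) *
      (((t * (1 - Real.exp (-(c / t) / μ))) ^ d * (1 - Real.exp (-(c / t) / μ)) ^ (n - d)) *
        Real.exp (-(c / t) / μ) ^ (NT - n))) atTop
      (𝓝 (∑ n ∈ Finset.Icc ξ NT, (NT.choose n : ℝ) *
        (((c / μ) ^ d * 0 ^ (n - d)) * 1 ^ (NT - n)))) :=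
    tendsto_finsetSum _ fun n _ =>
      (((hmul.pow d).mul (hsub.pow (n - d))).mul (hexp.pow (NT - n))).const_mul _
  simp only [one_pow, mul_one] at hsum
  refine hsum.congr fun t => ?_
  rw [FOrd, Finset.mul_sum]
  refine Finset.sum_congr rfl fun n hn => ?_
  obtain ⟨k, rfl⟩ := Nat.exists_eq_add_of_le (hd.trans (Finset.mem_Icc.mp hn).1)
  rw [Nat.add_sub_cancel_left, mul_pow, pow_add]
  ring

theorem tendsto_pow_mul_FOrd_self {NT d : ℕ} (hd : d ≤ NT) (μ c : ℝ) :
    Tendsto (fun t : ℝ => t ^ d * FOrd NT d μ (c / t)) atTop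
      (𝓝 ((NT.choose d : ℝ) * (c / μ) ^ d)) := by
  have h := tendsto_pow_mul_FOrd NT le_rfl μ c (d := d)
  rwa [Finset.sum_eq_single_of_mem d (Finset.left_mem_Icc.mpr hd), Nat.sub_self, pow_zero,
    mul_one] at h
  intro n hn hne
  have : n - d ≠ 0 := by grind
  simp [this]

theorem tendsto_pow_mul_FOrd_of_lt (NT : ℕ) {ξ d : ℕ} (hd : d < ξ) (μ c : ℝ) :
    Tendsto (fun t : ℝ => t ^ d * FOrd NT ξ μ (c / t)) atTop (𝓝 0) := by
  have h := tendsto_pow_mul_FOrd NT hd.le μ c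
  rwa [Finset.sum_eq_zero] at h
  intro n hn
  have : n - d ≠ 0 := by grind
  simp [this]

theorem tendsto_pow_mul_pW {NT NS d : ℕ} (hd : d ≤ NT - NS) (μ s : ℝ) (w : ℕ) :
    Tendsto (fun t : ℝ => t ^ d * pW NT NS μ s t w) atTop (𝓝 0) := by
  have h : Tendsto (fun t : ℝ => ∑ ξ ∈ Finset.Icc (NT - NS + 1) (NT - w + 1),
      ((NT - ξ).choose (w - 1) : ℝ) / (NS.choose w : ℝ) * (t ^ d * FOrd NT ξ μ (s * w / t)))
      atTop (𝓝 (∑ ξ ∈ Finset.Icc (NT - NS + 1) (NT - w + 1),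
        ((NT - ξ).choose (w - 1) : ℝ) / (NS.choose w : ℝ) * 0)) :=
    tendsto_finsetSum _ fun ξ hξ =>
      (tendsto_pow_mul_FOrd_of_lt NT (by grind) μ (s * w)).const_mul _
  simp only [mul_zero, Finset.sum_const_zero] at h
  refine h.congr fun t => ?_
  rw [pW, Finset.mul_sum]
  exact Finset.sum_congr rfl fun ξ _ => by ring

/-- The product term of an inclusion-exclusion is negligible when one factor vanishes. -/
theorem tendsto_mul_add_sub_mul {α : Type*} {l : Filter α} {r f g : α → ℝ} {a b : ℝ}
    (hf : Tendsto (fun x => r x * f x) l (𝓝 a)) (hg : Tendsto (fun x => r x * g x) l (𝓝 b))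
    (hg₀ : Tendsto g l (𝓝 0)) :
    Tendsto (fun x => r x * (f x + g x - f x * g x)) l (𝓝 (a + b)) := by
  have h := (hf.add hg).sub (hf.mul hg₀)
  rw [mul_zero, sub_zero] at h
  exact h.congr fun x => by ring

/-- High-SNR asymptotics of the decentralized average outage probability:
`lim_{t→∞} t^{N_T−N_S}·P̄_o(t)
  = [C(N_T,N_T−N_S)/2^{N_S}]·(μ₁^{−(N_T−N_S)}+μ₂^{−(N_T−N_S)})·s^{N_T−N_S}`. -/
theorem stmt_8 (NT NS : ℕ) (hNS : 1 ≤ NS) (hNT : NS < NT)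
    (μ₁ μ₂ s : ℝ) (hμ₁ : 0 < μ₁) (hμ₂ : 0 < μ₂) (hs : 0 < s) :
    Tendsto (fun t : ℝ => t ^ (NT - NS) * Pout NT NS μ₁ μ₂ s t) atTop
      (nhds ((NT.choose (NT - NS) : ℝ) / 2 ^ NS
        * (1 / μ₁ ^ (NT - NS) + 1 / μ₂ ^ (NT - NS)) * s ^ (NT - NS))) := by
  have hd : 0 < NT - NS := Nat.sub_pos_of_lt hNT
  have hF := tendsto_mul_add_sub_mul
    (tendsto_pow_mul_FOrd_self (Nat.sub_le NT NS) μ₁ s)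
    (tendsto_pow_mul_FOrd_self (Nat.sub_le NT NS) μ₂ s)
    (by simpa using tendsto_pow_mul_FOrd_of_lt NT hd μ₂ s)
  have hW (w : ℕ) := tendsto_mul_add_sub_mul
    (tendsto_pow_mul_pW (NT := NT) (NS := NS) le_rfl μ₁ s w)
    (tendsto_pow_mul_pW le_rfl μ₂ s w)
    (by simpa using tendsto_pow_mul_pW (Nat.zero_le (NT - NS)) μ₂ s w)
  have hsum := tendsto_finsetSum (Finset.Icc 1 NS)
    fun w _ => (hW w).const_mul (NS.choose w : ℝ)
  have h := (hF.add hsum).const_mul (1 / 2 ^ NS : ℝ)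
  simp only [add_zero, mul_zero, Finset.sum_const_zero] at h
  convert h.congr fun t => ?_ using 2
  · simp only [div_pow]
    ring
  · rw [Pout, mul_left_comm, mul_add _ (_ - _), Finset.mul_sum]
    congr 2
    exact Finset.sum_congr rfl fun w _ => by ring
end
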